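/- arXiv:2511.22926 — 2 statements merged into one kernel-verified Lean document; each statement's English description precedes it below -/
import Mathlib

section
/- Let {S_t} be a C₀-semigroup on L¹(ν) with generator (K*, D(K*)). Then {S_t} is positivity-preserving and mass-conserving if and only if for every ρ ∈ D(K*) one has ∫_Π K*ρ dν = 0 and ∫_{{ρ>0}} K*ρ dν ≤ 0. -/
open MeasureTheory Filter Topology

section SG
variable {E : Type*} [NormedAddCommGroup E] [NormedSpace ℝ E] [CompleteSpace E]

set_option linter.unusedSectionVars false

lemma sg_bound0 (T : ℝ → E →L[ℝ] E)
    (hc : ∀ f, Tendsto (fun t => T t f) (𝓝[≥] (0:ℝ)) (𝓝 f)) :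
    ∃ δ : ℝ, 0 < δ ∧ ∃ M : ℝ, 1 ≤ M ∧ ∀ s, 0 ≤ s → s ≤ δ → ‖T s‖ ≤ M := by
  by_contra! hcon
  have h1 : ∀ n : ℕ, ∃ s : ℝ, 0 ≤ s ∧ s ≤ 1 / ((n:ℝ) + 1) ∧ (n:ℝ) + 1 < ‖T s‖ := by
    intro n
    exact hcon (1 / ((n:ℝ)+1)) (by positivity) ((n:ℝ)+1) (by linarith [n.cast_nonneg (α := ℝ)])
  choose s hs0 hs1 hs2 using h1
  have hst : Tendsto s atTop (𝓝[≥] (0:ℝ)) := by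
    refine tendsto_nhdsWithin_iff.2 ⟨?_, Eventually.of_forall hs0⟩
    exact squeeze_zero hs0 hs1 tendsto_one_div_add_atTop_nhds_zero_nat
  obtain ⟨C, hC⟩ := banach_steinhaus (g := fun n => T (s n)) (by
    intro x
    have h2 := ((hc x).comp hst).norm
    obtain ⟨C, hC⟩ := h2.bddAbove_range
    exact ⟨C, fun n => hC ⟨n, rfl⟩⟩)
  obtain ⟨n, hn⟩ := exists_nat_gt C
  linarith [hC n, hs2 n]

lemma sg_bound (T : ℝ → E →L[ℝ] E) 
    (hT : ∀ s t : ℝ, 0 ≤ s → 0 ≤ t → ∀ f, T (s + t) f = T s (T t f))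
    (hc : ∀ f, Tendsto (fun t => T t f) (𝓝[≥] (0:ℝ)) (𝓝 f)) (t : ℝ) :
    ∃ M : ℝ, 1 ≤ M ∧ ∀ s, 0 ≤ s → s ≤ t → ‖T s‖ ≤ M := by
  obtain ⟨δ, hδ, M, hM, hb⟩ := sg_bound0 T hc
  have key : ∀ n : ℕ, ∀ s, 0 ≤ s → s ≤ (n + 1) * δ → ‖T s‖ ≤ M ^ (n + 1) := by
    intro n
    induction n with
    | zero => intro s h0 h1; simpa using hb s h0 (by simpa using h1)
    | succ n ih =>
      intro s h0 h1
      push_cast at h1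
      rcases le_total s δ with h | h
      · exact (hb s h0 h).trans (le_self_pow₀ hM (by omega))
      · refine ContinuousLinearMap.opNorm_le_bound _ (by positivity) fun x => ?_
        have e : s = δ + (s - δ) := by ring
        rw [e, hT _ _ hδ.le (by linarith)]
        calc ‖T δ (T (s - δ) x)‖ ≤ ‖T δ‖ * ‖T (s - δ) x‖ := (T δ).le_opNorm _
          _ ≤ M * (M ^ (n+1) * ‖x‖) := by
            gcongr
            · exact hb δ hδ.le le_rfl
            · exact (T (s - δ)).le_of_opNorm_le (ih (s - δ) (by linarith) (by linarith)) x
          _ = _ := by ring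
  obtain ⟨n, hn⟩ := exists_nat_gt (t / δ)
  refine ⟨M ^ (n+1), one_le_pow₀ hM, fun s h0 h1 => key n s h0 ?_⟩
  rw [div_lt_iff₀ hδ] at hn
  nlinarith

lemma sg_cont (T : ℝ → E →L[ℝ] E) 
    (hT : ∀ s t : ℝ, 0 ≤ s → 0 ≤ t → ∀ f, T (s + t) f = T s (T t f))
    (hc : ∀ f, Tendsto (fun t => T t f) (𝓝[≥] (0:ℝ)) (𝓝 f)) (f : E) :
    Continuous (fun s : ℝ => T (max s 0) f) := by
  rw [continuous_iff_continuousAt]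
  intro t
  obtain ⟨M, hM, hb⟩ := sg_bound T hT hc (max t 0 + 1)
  have hkey : ∀ a b : ℝ, 0 ≤ a → 0 ≤ b → a ≤ max t 0 + 1 → b ≤ max t 0 + 1 →
      ‖T a f - T b f‖ ≤ M * ‖T |a - b| f - f‖ := by
    have aux : ∀ a b : ℝ, 0 ≤ b → b ≤ a → b ≤ max t 0 + 1 →
      ‖T a f - T b f‖ ≤ M * ‖T |a - b| f - f‖ := by
      intro a b hb0 hba hb1
      have e : T a f = T b (T |a - b| f) := by
        rw [← hT _ _ hb0 (abs_nonneg _), abs_of_nonneg (by linarith)]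
        congr 2; ring
      rw [e, ← map_sub]
      exact (T b).le_of_opNorm_le (hb b hb0 hb1) _
    intro a b ha hb0 ha1 hb1
    rcases le_total b a with h | h
    · exact aux a b hb0 h hb1
    · rw [norm_sub_rev, abs_sub_comm]; exact aux b a ha h ha1
  have hlim : Tendsto (fun s : ℝ => |max s 0 - max t 0|) (𝓝 t) (𝓝[≥] (0:ℝ)) := by
    refine tendsto_nhdsWithin_iff.2 ⟨?_, Eventually.of_forall fun s => Set.mem_Ici.2 (abs_nonneg _)⟩
    have : Continuous (fun s : ℝ => |max s 0 - max t 0|) := by fun_prop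
    simpa using this.tendsto t
  have h2 : Tendsto (fun s : ℝ => M * ‖T |max s 0 - max t 0| f - f‖) (𝓝 t) (𝓝 0) := by
    have := (((hc f).comp hlim).sub_const f).norm.const_mul M
    simpa using this
  show Tendsto _ _ _
  rw [tendsto_iff_norm_sub_tendsto_zero]
  refine squeeze_zero' (Eventually.of_forall fun _ => norm_nonneg _) ?_ h2
  have hev : ∀ᶠ s in 𝓝 t, s < max t 0 + 1 :=
    eventually_lt_nhds (by linarith [le_max_left t 0])
  filter_upwards [hev] with s hs
  exact hkey _ _ (le_max_right _ _) (le_max_right _ _)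
    (max_le hs.le (by linarith [le_max_right t 0])) (by linarith)

/-- pairs in the graph of the generator -/
def SGGen (T : ℝ → E →L[ℝ] E) (f g : E) : Prop :=
  Tendsto (fun h : ℝ => h⁻¹ • (T h f - f)) (𝓝[>] (0:ℝ)) (𝓝 g)

lemma SGGen.map {T : ℝ → E →L[ℝ] E} 
    (hT : ∀ s t : ℝ, 0 ≤ s → 0 ≤ t → ∀ f, T (s + t) f = T s (T t f))
    {f g : E} (h : SGGen T f g) {t : ℝ} (ht : 0 ≤ t) : SGGen T (T t f) (T t g) := by
  have h1 := ((T t).continuous.tendsto g).comp h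
  refine h1.congr' ?_
  filter_upwards [self_mem_nhdsWithin] with r hr
  simp only [Function.comp, map_smul, map_sub]
  rw [← hT _ _ ht (le_of_lt hr), ← hT _ _ (le_of_lt hr) ht, add_comm]

lemma sg_avg (T : ℝ → E →L[ℝ] E) 
    (hT : ∀ s t : ℝ, 0 ≤ s → 0 ≤ t → ∀ f, T (s + t) f = T s (T t f))
    (hc : ∀ f, Tendsto (fun t => T t f) (𝓝[≥] (0:ℝ)) (𝓝 f)) (f : E) {a : ℝ} (ha : 0 < a) :
    SGGen T (∫ s in (0:ℝ)..a, T (max s 0) f) (T (max a 0) f - T (max 0 0) f) := by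
  have hcont := sg_cont T hT hc f
  have hint : ∀ x y, IntervalIntegrable (fun s : ℝ => T (max s 0) f) volume x y :=
    fun x y => hcont.intervalIntegrable x y
  have hd : ∀ b : ℝ, Tendsto (fun h : ℝ => h⁻¹ • ∫ s in b..(b+h), T (max s 0) f) (𝓝[>] (0:ℝ))
      (𝓝 (T (max b 0) f)) := by
    intro b
    have h1 : HasDerivAt (fun u => ∫ s in b..u, T (max s 0) f) (T (max b 0) f) b :=
      intervalIntegral.integral_hasDerivAt_right (hint b b)
        (hcont.stronglyMeasurableAtFilter _ _) hcont.continuousAt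
    have h2 := h1.tendsto_slope_zero_right
    simpa using h2
  have h3 := (hd a).sub (hd 0)
  refine h3.congr' ?_
  filter_upwards [self_mem_nhdsWithin] with r hr
  have hr : 0 < r := hr
  rw [← smul_sub]
  congr 1
  have e : T r (∫ s in (0:ℝ)..a, T (max s 0) f) = ∫ s in r..(a + r), T (max s 0) f := by
    rw [← ContinuousLinearMap.intervalIntegral_comp_comm _ (hint 0 a)]
    have : ∫ s in r..(a + r), T (max s 0) f = ∫ s in (0:ℝ)..a, T (max (s + r) 0) f := by
      rw [intervalIntegral.integral_comp_add_right (fun s => T (max s 0) f)]; simp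
    rw [this]
    refine intervalIntegral.integral_congr fun s hs => ?_
    rw [Set.uIcc_of_le ha.le] at hs
    have h0 : 0 ≤ s := hs.1
    rw [max_eq_left h0, max_eq_left (by linarith), add_comm, hT _ _ hr.le h0]
  rw [e, zero_add]
  have e1 := intervalIntegral.integral_add_adjacent_intervals (hint 0 r) (hint r (a + r))
  have e2 := intervalIntegral.integral_add_adjacent_intervals (hint 0 a) (hint a (a + r))
  rw [sub_eq_sub_iff_add_eq_add, add_comm, e2, ← e1]
  exact add_comm _ _

lemma sg_main (T : ℝ → E →L[ℝ] E) (hT0 : T 0 = 1)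
    (hT : ∀ s t : ℝ, 0 ≤ s → 0 ≤ t → ∀ f, T (s + t) f = T s (T t f))
    (hc : ∀ f, Tendsto (fun t => T t f) (𝓝[≥] (0:ℝ)) (𝓝 f))
    (φ : E → ℝ) (hφ : ∀ x y, φ x - φ y ≤ ‖x - y‖)
    (hD : ∀ f g, SGGen T f g → ∀ h : ℝ, 0 < h → φ f ≤ φ (f - h • g))
    {t : ℝ} (ht : 0 < t) (f : E) : φ (T t f) ≤ φ f := by
  obtain ⟨M, hM, hb⟩ := sg_bound T hT hc t
  -- step 1: on the domain
  have dom : ∀ f g, SGGen T f g → φ (T t f) ≤ φ f := by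
    intro f g hfg
    have key : ∀ h : ℝ, 0 < h → ∀ k : ℕ, k * h ≤ t →
        φ (T (k * h) f) ≤ φ f + k * (M * ‖T h f - f - h • T h g‖) := by
      intro h hh k
      induction k with
      | zero => intro _; simp [hT0]
      | succ k ih =>
        intro hk
        push_cast at hk ⊢
        have hkh : 0 ≤ (k:ℝ) * h := by positivity
        have ih := ih (by linarith)
        have h1 := hD _ _ (hfg.map hT (t := ((k:ℝ)+1) * h) (by positivity)) h hh
        have e : ∀ x, T (((k:ℝ)+1) * h) x = T (k * h) (T h x) := by
          intro x; rw [← hT _ _ hkh hh.le]; congr 2; ring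
        have h2 := hφ (T (((k:ℝ)+1) * h) f - h • T (((k:ℝ)+1) * h) g) (T (k * h) f)
        have h3 : ‖T (((k:ℝ)+1) * h) f - h • T (((k:ℝ)+1) * h) g - T (k * h) f‖
            ≤ M * ‖T h f - f - h • T h g‖ := by
          rw [e, e, ← map_smul, ← map_sub, ← map_sub, sub_right_comm]
          exact (T (k * h)).le_of_opNorm_le (hb _ hkh (by linarith)) _
        linarith
    have hseq : Tendsto (fun n : ℕ => t / ((n:ℝ) + 1)) atTop (𝓝[>] (0:ℝ)) := by
      refine tendsto_nhdsWithin_iff.2 ⟨?_, Eventually.of_forall fun n => ?_⟩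
      · have := (tendsto_one_div_add_atTop_nhds_zero_nat (𝕜 := ℝ)).const_mul t
        simpa [div_eq_mul_inv] using this
      · exact div_pos ht (by positivity)
    have hlim : Tendsto (fun h : ℝ => φ f + t * (M * ‖h⁻¹ • (T h f - f) - T h g‖)) (𝓝[>] (0:ℝ))
        (𝓝 (φ f)) := by
      have hg := (hc g).mono_left (nhdsWithin_mono (0:ℝ) Set.Ioi_subset_Ici_self)
      have := (((hfg.sub hg).norm.const_mul M).const_mul t).const_add (φ f)
      simpa using this
    refine ge_of_tendsto' (hlim.comp hseq) fun n => ?_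
    have hn : 0 < (n:ℝ) + 1 := by positivity
    have h4 := key (t / ((n:ℝ)+1)) (div_pos ht hn) (n+1) (by push_cast; field_simp; rfl)
    push_cast at h4
    have e5 : ((n:ℝ) + 1) * (t / (n+1)) = t := by field_simp
    rw [e5] at h4
    refine h4.trans (le_of_eq ?_)
    simp only [Function.comp]
    set h := t / ((n:ℝ)+1) with hh
    have hpos : 0 < h := div_pos ht hn
    have e6 : T h f - f - h • T h g = h • (h⁻¹ • (T h f - f) - T h g) := by
      rw [smul_sub, smul_smul, mul_inv_cancel₀ hpos.ne', one_smul]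
    rw [e6, norm_smul, Real.norm_of_nonneg hpos.le]
    conv_rhs => rw [← e5]
    ring
  have hφc : Continuous φ := by
    refine LipschitzWith.continuous (K := 1) (LipschitzWith.of_le_add_mul 1 fun x y => ?_)
    have := hφ x y
    rw [dist_eq_norm]; simp; linarith
  have havg : Tendsto (fun a : ℝ => a⁻¹ • ∫ s in (0:ℝ)..a, T (max s 0) f) (𝓝[>] (0:ℝ)) (𝓝 f) := by
    have hcont := sg_cont T hT hc f
    have h1 : HasDerivAt (fun u => ∫ s in (0:ℝ)..u, T (max s 0) f) (T (max 0 0) f) 0 :=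
      intervalIntegral.integral_hasDerivAt_right (hcont.intervalIntegrable _ _)
        (hcont.stronglyMeasurableAtFilter _ _) hcont.continuousAt
    have h2 := h1.tendsto_slope_zero_right
    simpa [hT0] using h2
  refine le_of_tendsto_of_tendsto ((hφc.tendsto _).comp (((T t).continuous.tendsto _).comp havg))
    ((hφc.tendsto _).comp havg) ?_
  filter_upwards [self_mem_nhdsWithin] with a ha
  have h7 := sg_avg T hT hc f (a := a) ha
  refine dom _ (a⁻¹ • (T (max a 0) f - T (max 0 0) f)) ?_
  have h8 := h7.const_smul a⁻¹
  refine h8.congr fun r => ?_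
  rw [map_smul, ← smul_sub, smul_comm]
end SG

lemma fwd_lim {X : Type*} [MeasurableSpace X] (ν : Measure X) (A : Set X)
    (u : ℝ → X → ℝ) (g : X → ℝ) (hu : ∀ h, 0 < h → Integrable (u h) ν) (hg : Integrable g ν)
    (hl : Tendsto (fun h : ℝ => ∫ x, |u h x - g x| ∂ν) (𝓝[>] (0:ℝ)) (𝓝 0)) :
    Tendsto (fun h : ℝ => ∫ x in A, u h x ∂ν) (𝓝[>] (0:ℝ)) (𝓝 (∫ x in A, g x ∂ν)) := by
  rw [tendsto_iff_norm_sub_tendsto_zero]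
  refine squeeze_zero' (Eventually.of_forall fun _ => norm_nonneg _) ?_ hl
  filter_upwards [self_mem_nhdsWithin] with h hh
  have hi := (hu h hh)
  rw [← integral_sub hi.integrableOn hg.integrableOn]
  refine (norm_integral_le_integral_norm _).trans ?_
  exact setIntegral_le_integral (hi.sub hg).norm (Eventually.of_forall fun _ => norm_nonneg _)

lemma integral_pos_set {X : Type*} [MeasurableSpace X] (ν : Measure X)
    (f : X → ℝ) (hf : Integrable f ν) :
    ∫ x in {x | 0 < f x}, f x ∂ν = ∫ x, max (f x) 0 ∂ν := by
  have hA : NullMeasurableSet {x | 0 < f x} ν :=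
    nullMeasurableSet_lt aemeasurable_const hf.aemeasurable
  rw [← integral_indicator₀ hA]
  congr 1
  ext x
  by_cases h : 0 < f x
  · rw [Set.indicator_of_mem (by exact h), max_eq_left h.le]
  · rw [Set.indicator_of_notMem (by exact h), max_eq_right (not_lt.1 h)]

lemma fwd_dir {X : Type*} [MeasurableSpace X] (ν : Measure X) 
    (S : ℝ → (X → ℝ) → (X → ℝ))
    (hadd : ∀ t : ℝ, 0 ≤ t → ∀ f g : X → ℝ, S t (f + g) = S t f + S t g)
    (hint : ∀ t : ℝ, 0 ≤ t → ∀ f : X → ℝ, Integrable f ν → Integrable (S t f) ν)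
    (H : ∀ t : ℝ, 0 ≤ t → ∀ f : X → ℝ, Integrable f ν →
        ((0 ≤ᵐ[ν] f → 0 ≤ᵐ[ν] S t f) ∧ ∫ x, S t f x ∂ν = ∫ x, f x ∂ν))
    (f g : X → ℝ) (hf : Integrable f ν) (hg : Integrable g ν)
    (hl : Tendsto (fun h : ℝ => ∫ x, |h⁻¹ * (S h f x - f x) - g x| ∂ν)
        (𝓝[>] (0:ℝ)) (𝓝 0)) :
    ∫ x, g x ∂ν = 0 ∧ ∫ x in {x | 0 < f x}, g x ∂ν ≤ 0 := by
  have hl2 := fun A => fwd_lim ν A (fun h x => h⁻¹ * (S h f x - f x)) g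
    (fun h hh => ((hint h hh.le f hf).sub hf).const_mul _) hg hl
  constructor
  · have h1 := hl2 Set.univ
    simp only [Measure.restrict_univ] at h1
    refine tendsto_nhds_unique h1 (tendsto_const_nhds.congr' ?_)
    filter_upwards [self_mem_nhdsWithin] with h hh
    have hh : 0 < h := hh
    rw [integral_const_mul, integral_sub (hint h hh.le f hf) hf, (H h hh.le f hf).2]
    simp
  · refine le_of_tendsto (hl2 {x | 0 < f x}) ?_
    filter_upwards [self_mem_nhdsWithin] with h hh
    have hh : 0 < h := hh
    have hSf := hint h hh.le f hf
    rw [integral_const_mul, integral_sub hSf.integrableOn hf.integrableOn]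
    refine mul_nonpos_of_nonneg_of_nonpos (by positivity) ?_
    rw [sub_nonpos, integral_pos_set ν f hf]
    have hp : Integrable (fun x => max (f x) 0) ν := hf.pos_part
    have hSp := hint h hh.le _ hp
    have p1 := (H h hh.le _ hp).1 (Eventually.of_forall fun x => le_max_right _ _)
    have hd : Integrable (fun x => max (f x) 0 - f x) ν := hp.sub hf
    have p2 := (H h hh.le _ hd).1
      (Eventually.of_forall fun x => sub_nonneg.2 (le_max_left _ _))
    have e : S h (fun x => max (f x) 0) = S h (fun x => max (f x) 0 - f x) + S h f := by
      rw [← hadd h hh.le]; congr 1; ext x; simp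
    rw [← (H h hh.le _ hp).2]
    calc ∫ x in {x | 0 < f x}, S h f x ∂ν
        ≤ ∫ x in {x | 0 < f x}, S h (fun x => max (f x) 0) x ∂ν := by
          refine integral_mono_ae hSf.integrableOn hSp.integrableOn (ae_restrict_of_ae ?_)
          filter_upwards [p2] with x hx
          rw [e]
          simpa using hx
      _ ≤ _ := setIntegral_le_integral hSp p1

lemma l1_norm_eq {X : Type*} [MeasurableSpace X] {ν : Measure X} (F : Lp ℝ 1 ν) (u : X → ℝ)
    (h : F =ᵐ[ν] u) : ‖F‖ = ∫ x, |u x| ∂ν := by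
  rw [L1.norm_eq_integral_norm]
  exact integral_congr_ae (h.mono fun x hx => by simp [hx])

/-- the semigroup on L1 -/
noncomputable def sgL1 {X : Type*} [MeasurableSpace X] (ν : Measure X)
    (S : ℝ → (X → ℝ) → (X → ℝ))
    (hadd : ∀ t : ℝ, 0 ≤ t → ∀ f g : X → ℝ, S t (f + g) = S t f + S t g)
    (hsmul : ∀ t : ℝ, 0 ≤ t → ∀ (c : ℝ) (f : X → ℝ), S t (c • f) = c • S t f)
    (hint : ∀ t : ℝ, 0 ≤ t → ∀ f : X → ℝ, Integrable f ν → Integrable (S t f) ν)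
    (hae : ∀ t : ℝ, 0 ≤ t → ∀ f g : X → ℝ, Integrable f ν → Integrable g ν →
      f =ᵐ[ν] g → S t f =ᵐ[ν] S t g)
    (t : ℝ) (ht : 0 ≤ t) : Lp ℝ 1 ν →ₗ[ℝ] Lp ℝ 1 ν where
  toFun F := (hint t ht F (L1.integrable_coeFn F)).toL1
  map_add' F G := by
    rw [← Integrable.toL1_add, Integrable.toL1_eq_toL1_iff, ← hadd t ht]
    exact hae t ht _ _ (L1.integrable_coeFn _)
      ((L1.integrable_coeFn _).add (L1.integrable_coeFn _)) (Lp.coeFn_add F G)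
  map_smul' c F := by
    simp only [RingHom.id_apply]
    rw [← Integrable.toL1_smul, Integrable.toL1_eq_toL1_iff]
    have := hae t ht _ _ (L1.integrable_coeFn _)
      ((L1.integrable_coeFn _).smul c) (Lp.coeFn_smul c F)
    rwa [hsmul t ht] at this

lemma sg_exists {X : Type*} [MeasurableSpace X] (ν : Measure X)
    (S : ℝ → (X → ℝ) → (X → ℝ))
    (hadd : ∀ t : ℝ, 0 ≤ t → ∀ f g : X → ℝ, S t (f + g) = S t f + S t g)
    (hsmul : ∀ t : ℝ, 0 ≤ t → ∀ (c : ℝ) (f : X → ℝ), S t (c • f) = c • S t f)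
    (hbdd : ∀ t : ℝ, 0 ≤ t → ∃ C : ℝ, ∀ f : X → ℝ, Integrable f ν →
      Integrable (S t f) ν ∧ ∫ x, |S t f x| ∂ν ≤ C * ∫ x, |f x| ∂ν) :
    ∃ T : ℝ → Lp ℝ 1 ν →L[ℝ] Lp ℝ 1 ν, ∀ t, 0 ≤ t → ∀ (F : Lp ℝ 1 ν) (f : X → ℝ),
      F =ᵐ[ν] f → T t F =ᵐ[ν] S t f := by
  have hint : ∀ t : ℝ, 0 ≤ t → ∀ f : X → ℝ, Integrable f ν → Integrable (S t f) ν := by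
    intro t ht f hf
    obtain ⟨C, hC⟩ := hbdd t ht
    exact (hC f hf).1
  have hae : ∀ t : ℝ, 0 ≤ t → ∀ f g : X → ℝ, Integrable f ν → Integrable g ν →
      f =ᵐ[ν] g → S t f =ᵐ[ν] S t g := by
    intro t ht f g hf hg hfg
    obtain ⟨C, hC⟩ := hbdd t ht
    have h1 := hC (f - g) (hf.sub hg)
    have h0 : ∫ x, |(f - g) x| ∂ν = 0 := by
      rw [integral_eq_zero_of_ae]
      filter_upwards [hfg] with x hx
      simp [hx]
    rw [h0, mul_zero] at h1
    have h2 : ∫ x, |S t (f - g) x| ∂ν = 0 :=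
      le_antisymm h1.2 (integral_nonneg fun _ => abs_nonneg _)
    rw [integral_eq_zero_iff_of_nonneg (fun _ => abs_nonneg _) h1.1.abs] at h2
    have e : S t f = S t (f - g) + S t g := by rw [← hadd t ht]; simp
    filter_upwards [h2] with x hx
    rw [e]
    simpa using hx
  have hT : ∀ t : ℝ, 0 ≤ t → ∃ T : Lp ℝ 1 ν →L[ℝ] Lp ℝ 1 ν, ∀ (F : Lp ℝ 1 ν) (f : X → ℝ),
      F =ᵐ[ν] f → T F =ᵐ[ν] S t f := by
    intro t ht
    obtain ⟨C, hC⟩ := hbdd t ht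
    refine ⟨(sgL1 ν S hadd hsmul hint hae t ht).mkContinuous C fun F => ?_, fun F f hFf => ?_⟩
    · have := (hC F (L1.integrable_coeFn F)).2
      rw [l1_norm_eq F F (ae_eq_refl _), l1_norm_eq (sgL1 ν S hadd hsmul hint hae t ht F) (S t F)
        (Integrable.coeFn_toL1 (hint t ht F (L1.integrable_coeFn F)))]
      exact this
    · have hf : Integrable f ν := (L1.integrable_coeFn F).congr hFf
      exact (Integrable.coeFn_toL1 (hint t ht F (L1.integrable_coeFn F))).trans
        (hae t ht F f (L1.integrable_coeFn F) hf hFf)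
  choose T hT using hT
  refine ⟨fun t => if ht : 0 ≤ t then T t ht else 0, fun t ht F f hFf => ?_⟩
  simp only [ht, dif_pos]
  exact hT t ht F f hFf

lemma bwd_dir {X : Type*} [MeasurableSpace X] (ν : Measure X)
    (S : ℝ → (X → ℝ) → (X → ℝ))
    (hS0 : ∀ f, S 0 f = f)
    (hSsemi : ∀ s t : ℝ, 0 ≤ s → 0 ≤ t → ∀ f, S (s + t) f = S s (S t f))
    (hadd : ∀ t : ℝ, 0 ≤ t → ∀ f g : X → ℝ, S t (f + g) = S t f + S t g)
    (hsmul : ∀ t : ℝ, 0 ≤ t → ∀ (c : ℝ) (f : X → ℝ), S t (c • f) = c • S t f)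
    (hbdd : ∀ t : ℝ, 0 ≤ t → ∃ C : ℝ, ∀ f : X → ℝ, Integrable f ν →
      Integrable (S t f) ν ∧ ∫ x, |S t f x| ∂ν ≤ C * ∫ x, |f x| ∂ν)
    (hcont : ∀ f : X → ℝ, Integrable f ν →
      Tendsto (fun t => ∫ x, |S t f x - f x| ∂ν) (𝓝[≥] (0:ℝ)) (𝓝 0))
    (H : ∀ f g : X → ℝ, Integrable f ν → Integrable g ν →
      Tendsto (fun h : ℝ => ∫ x, |h⁻¹ * (S h f x - f x) - g x| ∂ν)
        (𝓝[>] (0:ℝ)) (𝓝 0) →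
      (∫ x, g x ∂ν = 0 ∧ ∫ x in {x | 0 < f x}, g x ∂ν ≤ 0))
    (t : ℝ) (ht : 0 < t) (f : X → ℝ) (hf : Integrable f ν) :
    (0 ≤ᵐ[ν] f → 0 ≤ᵐ[ν] S t f) ∧ ∫ x, S t f x ∂ν = ∫ x, f x ∂ν := by
  obtain ⟨T, hTS⟩ := sg_exists ν S hadd hsmul hbdd
  have hI : ∀ F : Lp ℝ 1 ν, Integrable F ν := L1.integrable_coeFn
  have hT0 : T 0 = 1 := by
    ext1 F
    refine Lp.ext ((hTS 0 le_rfl F F (ae_eq_refl _)).trans ?_)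
    rw [hS0]; rfl
  have hT : ∀ s t : ℝ, 0 ≤ s → 0 ≤ t → ∀ f, T (s + t) f = T s (T t f) := by
    intro s t hs ht F
    refine Lp.ext ((hTS (s+t) (by positivity) F F (ae_eq_refl _)).trans ?_)
    rw [hSsemi s t hs ht]
    exact (hTS s hs _ _ (hTS t ht F F (ae_eq_refl _))).symm
  have hc : ∀ f, Tendsto (fun t => T t f) (𝓝[≥] (0:ℝ)) (𝓝 f) := by
    intro F
    rw [tendsto_iff_norm_sub_tendsto_zero]
    refine (hcont F (hI F)).congr' ?_
    filter_upwards [self_mem_nhdsWithin] with r hr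
    refine (l1_norm_eq _ _ ?_).symm
    filter_upwards [Lp.coeFn_sub (T r F) F, hTS r hr F F (ae_eq_refl _)] with x h1 h2
    rw [h1, Pi.sub_apply, h2]
  have hD : ∀ F G, SGGen T F G → ∫ x, G x ∂ν = 0 ∧ ∫ x in {x | 0 < F x}, G x ∂ν ≤ 0 := by
    intro F G hFG
    refine H F G (hI F) (hI G) ?_
    unfold SGGen at hFG
    rw [tendsto_iff_norm_sub_tendsto_zero] at hFG
    refine hFG.congr' ?_
    filter_upwards [self_mem_nhdsWithin] with r hr
    refine (l1_norm_eq _ _ ?_)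
    filter_upwards [Lp.coeFn_sub (r⁻¹ • (T r F - F)) G, Lp.coeFn_smul r⁻¹ (T r F - F),
      Lp.coeFn_sub (T r F) F, hTS r (le_of_lt hr) F F (ae_eq_refl _)] with x h1 h2 h3 h4
    rw [h1, Pi.sub_apply, h2, Pi.smul_apply, h3, Pi.sub_apply, h4, smul_eq_mul]
  have hfF := hf.coeFn_toL1
  set F := hf.toL1 f with hF
  have hSF := hTS t ht.le F f hfF
  -- mass
  have hsub : ∀ A B : Lp ℝ 1 ν, ∫ x, (A - B) x ∂ν = ∫ x, A x ∂ν - ∫ x, B x ∂ν := by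
    intro A B
    rw [integral_congr_ae (Lp.coeFn_sub A B)]
    exact integral_sub (hI A) (hI B)
  have hle : ∀ A : Lp ℝ 1 ν, |∫ x, A x ∂ν| ≤ ‖A‖ := by
    intro A
    rw [L1.norm_eq_integral_norm]
    exact norm_integral_le_integral_norm (fun x => A x)
  have hstep : ∀ A B : Lp ℝ 1 ν, SGGen T A B → ∀ h : ℝ,
      ∫ x, (A - h • B) x ∂ν = ∫ x, A x ∂ν := by
    intro A B hAB h
    rw [hsub, integral_congr_ae (Lp.coeFn_smul h B)]
    simp [integral_const_mul, (hD A B hAB).1]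
  have m1 := sg_main T hT0 hT hc (fun A => ∫ x, A x ∂ν)
    (fun A B => by rw [← hsub]; exact (le_abs_self _).trans (hle _))
    (fun A B hAB h _ => (hstep A B hAB h).ge) ht F
  have m2 := sg_main T hT0 hT hc (fun A => -∫ x, A x ∂ν)
    (fun A B => by
      have h1 := (neg_le_abs _).trans (hle (A - B))
      rw [hsub] at h1
      linarith)
    (fun A B hAB h _ => by
      show -_ ≤ -_
      rw [hstep A B hAB h]) ht F
  beta_reduce at m1 m2
  rw [integral_congr_ae hSF, integral_congr_ae hfF] at m1 m2
  refine ⟨fun hpos => ?_, by linarith⟩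
  have hN : ∀ A : Lp ℝ 1 ν, Integrable (fun x => max (-A x) 0) ν := fun A => (hI A).neg_part
  have m3 := sg_main T hT0 hT hc (fun A => ∫ x, max (-A x) 0 ∂ν)
    (fun A B => by
      rw [← integral_sub (hN A) (hN B), L1.norm_eq_integral_norm]
      refine integral_mono_ae ((hN A).sub (hN B)) (hI (A - B)).norm ?_
      filter_upwards [Lp.coeFn_sub A B] with x hx
      rw [hx, Pi.sub_apply, Real.norm_eq_abs]
      have h1 := neg_le_abs (A x - B x)
      have h2 := abs_nonneg (A x - B x)
      have h3 := le_max_left (-B x) 0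
      have h4 := le_max_right (-B x) 0
      have : max (-A x) 0 ≤ max (-B x) 0 + |A x - B x| := max_le (by linarith) (by linarith)
      show max (-A x) 0 - max (-B x) 0 ≤ _
      linarith)
    (fun A B hAB h hh => by
      have hneg : SGGen T (-A) (-B) := by
        refine hAB.neg.congr fun r => ?_
        rw [map_neg, ← smul_neg]; congr 1; abel
      have h1 := (hD _ _ hneg).2
      have h2 : ∫ x in {x | 0 < -A x}, -B x ∂ν ≤ 0 := by
        have e1 : ({x | 0 < (-A : Lp ℝ 1 ν) x} : Set X) =ᵐ[ν] {x | 0 < -A x} := by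
          filter_upwards [Lp.coeFn_neg A] with x hx
          apply propext
          show 0 < (-A : Lp ℝ 1 ν) x ↔ 0 < -A x
          rw [hx]; rfl
        rw [setIntegral_congr_set e1, integral_congr_ae (ae_restrict_of_ae (Lp.coeFn_neg B))] at h1
        exact h1
      have e2 := integral_pos_set ν (fun x => -A x) (hI A).neg
      show ∫ x, max (-A x) 0 ∂ν ≤ ∫ x, max (-(A - h • B : Lp ℝ 1 ν) x) 0 ∂ν
      rw [← e2]
      have hi : Integrable (fun x => -A x - h * (-B x)) ν := (hI A).neg.sub ((hI B).neg.const_mul h)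
      calc ∫ x in {x | 0 < -A x}, -A x ∂ν
          ≤ ∫ x in {x | 0 < -A x}, (-A x - h * (-B x)) ∂ν := by
            have i1 : Integrable (fun x => -A x) ν := (hI A).neg
            have i2 : Integrable (fun x => h * (-B x)) ν := (hI B).neg.const_mul h
            rw [integral_sub i1.integrableOn i2.integrableOn,
              integral_const_mul]
            have := mul_nonpos_of_nonneg_of_nonpos hh.le h2
            linarith
        _ = ∫ x in {x | 0 < -A x}, -(A - h • B : Lp ℝ 1 ν) x ∂ν := by
            refine integral_congr_ae (ae_restrict_of_ae ?_)
            filter_upwards [Lp.coeFn_sub A (h • B), Lp.coeFn_smul h B] with x h3 h4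
            rw [h3, Pi.sub_apply, h4, Pi.smul_apply, smul_eq_mul]; ring
        _ ≤ ∫ x in {x | 0 < -A x}, max (-(A - h • B : Lp ℝ 1 ν) x) 0 ∂ν :=
            integral_mono (hI _).neg.integrableOn (hN _).integrableOn fun x => le_max_left _ _
        _ ≤ _ := setIntegral_le_integral (hN _)
            (Eventually.of_forall fun x => le_max_right _ _)) ht F
  beta_reduce at m3
  have h0 : ∫ x, max (-F x) 0 ∂ν = 0 := by
    refine integral_eq_zero_of_ae ?_
    filter_upwards [hfF, hpos] with x h1 h2
    rw [h1]
    simpa using h2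
  rw [h0] at m3
  have h5 := le_antisymm m3 (integral_nonneg fun x => le_max_right _ _)
  have h5 := (integral_eq_zero_iff_of_nonneg (f := fun x => max (-(T t F) x) 0)
    (fun x => le_max_right _ _) (hN _)).1 h5
  filter_upwards [h5, hSF] with x h6 h7
  rw [← h7]
  have := le_max_left (-(T t F) x) 0
  rw [h6] at this
  simpa using this

/-- Schilling's characterization of adjoint Markov semigroups: a C₀-semigroup {S_t} on
L¹(ν) is positivity-preserving and mass-conserving if and only if for every pair (ρ, g)
in the graph of its infinitesimal generator (g being the L¹-limit of h⁻¹(S_hρ − ρ) as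
h ↓ 0) one has ∫ g dν = 0 (mass conservation) and ∫_{ρ>0} g dν ≤ 0 (positive maximum
principle). -/
theorem stmt_11 {X : Type*} [MeasurableSpace X] (ν : Measure X) [IsFiniteMeasure ν]
    (S : ℝ → (X → ℝ) → (X → ℝ))
    (hS0 : ∀ f, S 0 f = f)
    (hSsemi : ∀ s t : ℝ, 0 ≤ s → 0 ≤ t → ∀ f, S (s + t) f = S s (S t f))
    (hadd : ∀ t : ℝ, 0 ≤ t → ∀ f g : X → ℝ, S t (f + g) = S t f + S t g)
    (hsmul : ∀ t : ℝ, 0 ≤ t → ∀ (c : ℝ) (f : X → ℝ), S t (c • f) = c • S t f)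
    (hbdd : ∀ t : ℝ, 0 ≤ t → ∃ C : ℝ, ∀ f : X → ℝ, Integrable f ν →
      Integrable (S t f) ν ∧ ∫ x, |S t f x| ∂ν ≤ C * ∫ x, |f x| ∂ν)
    (hcont : ∀ f : X → ℝ, Integrable f ν →
      Tendsto (fun t => ∫ x, |S t f x - f x| ∂ν) (𝓝[≥] (0:ℝ)) (𝓝 0)) :
    (∀ t : ℝ, 0 ≤ t → ∀ f : X → ℝ, Integrable f ν →
        ((0 ≤ᵐ[ν] f → 0 ≤ᵐ[ν] S t f) ∧ ∫ x, S t f x ∂ν = ∫ x, f x ∂ν)) ↔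
    (∀ f g : X → ℝ, Integrable f ν → Integrable g ν →
      Tendsto (fun h : ℝ => ∫ x, |h⁻¹ * (S h f x - f x) - g x| ∂ν)
        (𝓝[>] (0:ℝ)) (𝓝 0) →
      (∫ x, g x ∂ν = 0 ∧ ∫ x in {x | 0 < f x}, g x ∂ν ≤ 0)) := by
  have hint : ∀ t : ℝ, 0 ≤ t → ∀ f : X → ℝ, Integrable f ν → Integrable (S t f) ν := by
    intro t ht f hf
    obtain ⟨C, hC⟩ := hbdd t ht
    exact (hC f hf).1
  constructor
  · intro H f g hf hg hl
    exact fwd_dir ν S hadd hint H f g hf hg hl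
  · intro H t ht f hf
    rcases ht.eq_or_lt with rfl | ht
    · simp [hS0]
    · exact bwd_dir ν S hS0 hSsemi hadd hsmul hbdd hcont H t ht f hf
end

section
/- Let (Π,ν) be a finite measure space and, for each N, let ρ^{(N)} and σ^{(N)} be probability densities on Π^N with respect to ν^{⊗N}, and define the renormalized relative entropy H_N(ρ^{(N)}‖σ^{(N)}) = (1/N)∫ ρ^{(N)} log(ρ^{(N)}/σ^{(N)}) dν^{⊗N}. If ρ^{(N)} is permutation-invariant and σ^{(N)} = σ^{⊗N} for a fixed probability density σ, then for any 1 ≤ k ≤ N, the k-marginal ρ^{(N|k)} satisfies ‖ρ^{(N|k)} − σ^{⊗k}‖_{L¹(ν^{⊗k})} ≤ √( 2k H_N(ρ^{(N)} ‖ σ^{⊗N}) ). -/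
open MeasureTheory
open scoped ENNReal

lemma aux_pi_withDensity {X : Type*} [MeasurableSpace X] (ν : Measure X) [IsFiniteMeasure ν]
    (n : ℕ) (σ : X → ℝ) (hσ0 : 0 ≤ σ) (hσi : Integrable σ ν) :
    Measure.pi (fun _ : Fin n => ν.withDensity (fun x => ENNReal.ofReal (σ x))) =
      (Measure.pi fun _ : Fin n => ν).withDensity
        (fun x => ENNReal.ofReal (∏ i, σ (x i))) := by
  have : IsFiniteMeasure (ν.withDensity (fun x => ENNReal.ofReal (σ x))) :=
    isFiniteMeasure_withDensity_ofReal hσi.2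
  refine Measure.pi_eq fun s hs => ?_
  have hms : MeasurableSet (Set.pi Set.univ s) := MeasurableSet.univ_pi hs
  rw [withDensity_apply _ hms, ← lintegral_indicator hms]
  have e1 : ∀ x : Fin n → X, (Set.pi Set.univ s).indicator
      (fun x => ENNReal.ofReal (∏ i, σ (x i))) x
      = ENNReal.ofReal (∏ i, (s i).indicator σ (x i)) := by
    intro x
    by_cases hx : x ∈ Set.pi Set.univ s
    · rw [Set.indicator_of_mem hx]
      congr 1
      refine Finset.prod_congr rfl fun i _ => ?_
      rw [Set.indicator_of_mem (hx i (Set.mem_univ i))]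
    · rw [Set.indicator_of_notMem hx]
      simp only [Set.mem_pi, Set.mem_univ, forall_true_left, not_forall] at hx
      obtain ⟨i, hi⟩ := hx
      rw [Finset.prod_eq_zero (Finset.mem_univ i) (Set.indicator_of_notMem hi _)]
      simp
  have hi0 : ∀ i x, 0 ≤ (s i).indicator σ x := fun i x => Set.indicator_nonneg (fun x _ => hσ0 x) x
  have hii : ∀ i, Integrable ((s i).indicator σ) ν := fun i => hσi.indicator (hs i)
  simp_rw [e1]
  rw [← ofReal_integral_eq_lintegral_ofReal (Integrable.fintype_prod hii)
    (Filter.Eventually.of_forall fun x => Finset.prod_nonneg fun i _ => hi0 i _),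
    integral_fintype_prod_eq_prod (f := fun i => (s i).indicator σ),
    ENNReal.ofReal_prod_of_nonneg (fun i _ => integral_nonneg (hi0 i))]
  refine Finset.prod_congr rfl fun i _ => ?_
  rw [withDensity_apply _ (hs i), integral_indicator (hs i),
    ofReal_integral_eq_lintegral_ofReal hσi.integrableOn
    (Filter.Eventually.of_forall fun x => hσ0 x)]

lemma aux_glue {X : Type*} [MeasurableSpace X] (ν : Measure X) [IsFiniteMeasure ν]
    (N k : ℕ) (hkN : k ≤ N)
    (T : (Fin k → X) × (Fin (N - k) → X) → (Fin N → X))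
    (hT1 : ∀ p (i : Fin N) (a : Fin k), (i : ℕ) = a → T p i = p.1 a)
    (hT2 : ∀ p (i : Fin N) (b : Fin (N - k)), (i : ℕ) = k + b → T p i = p.2 b) :
    MeasurePreserving T
      ((Measure.pi fun _ : Fin k => ν).prod (Measure.pi fun _ : Fin (N - k) => ν))
      (Measure.pi fun _ : Fin N => ν) := by
  let e : Fin k ⊕ Fin (N - k) ≃ Fin N := finSumFinEquiv.trans (finCongr (by omega))
  have h := (measurePreserving_piCongrLeft (α := fun _ => X) (fun _ : Fin N => ν) e).comp
    (measurePreserving_sumPiEquivProdPi_symm (fun _ : Fin k ⊕ Fin (N - k) => ν))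
  convert h using 1
  ext p i
  obtain ⟨j, rfl⟩ := e.surjective i
  rw [Function.comp_apply, MeasurableEquiv.piCongrLeft_apply_apply]
  rcases j with a | b
  · rw [hT1 p _ a (by simp [e])]
    simp [MeasurableEquiv.sumPiEquivProdPi, Equiv.sumPiEquivProdPi]
  · rw [hT2 p _ b (by simp [e])]
    simp [MeasurableEquiv.sumPiEquivProdPi, Equiv.sumPiEquivProdPi]

lemma aux_proj {X : Type*} [MeasurableSpace X] (μ : Measure X) [IsProbabilityMeasure μ]
    (N k : ℕ) (g : Fin k → Fin N) (hg : Function.Injective g) :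
    MeasurePreserving (fun x : Fin N → X => fun a => x (g a))
      (Measure.pi fun _ : Fin N => μ) (Measure.pi fun _ : Fin k => μ) := by
  refine ⟨by fun_prop, ?_⟩
  have h := (ProbabilityTheory.iIndepFun_pi (μ := fun _ : Fin N => μ)
    (X := fun _ (x : X) => x) (fun _ => aemeasurable_id)).precomp hg
  rw [ProbabilityTheory.iIndepFun_iff_map_fun_eq_pi_map
    (fun i => (measurable_pi_apply (g i)).aemeasurable)] at h
  refine h.trans ?_
  congr 1
  ext1 a
  exact (measurePreserving_eval (fun _ : Fin N => μ) (g a)).map_eq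

lemma aux_finner {X : Type*} [MeasurableSpace X] (μ : Measure X) [IsProbabilityMeasure μ]
    {ι J : Type*} [Fintype ι] [DecidableEq ι] [Fintype J] (S : J → Finset ι)
    (p : ℝ) (hp : 0 ≤ p)
    (hS : ∀ i, ∑ _j ∈ Finset.univ.filter (fun j => i ∈ S j), p = 1)
    (f : J → (ι → X) → ℝ≥0∞) (hf : ∀ j, Measurable (f j))
    (hfS : ∀ j, ∀ i ∉ S j, ∀ x a, f j (Function.update x i a) = f j x) :
    ∫⁻ x, ∏ j, f j x ^ p ∂(Measure.pi fun _ : ι => μ) ≤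
      ∏ j, (∫⁻ x, f j x ∂(Measure.pi fun _ : ι => μ)) ^ p := by
  have hF : Measurable (fun x => ∏ j, f j x ^ p) := by fun_prop
  have key : ∀ s : Finset ι, ∀ x, (∫⋯∫⁻_s, (fun x => ∏ j, f j x ^ p) ∂(fun _ => μ)) x ≤
      ∏ j, ((∫⋯∫⁻_s, f j ∂(fun _ => μ)) x) ^ p := by
    intro s
    induction s using Finset.induction with
    | empty => intro x; simp
    | insert i s hi ih =>
      intro x
      rw [lmarginal_insert _ hF hi]
      have hconst : ∀ j, i ∉ S j → ∀ a, (∫⋯∫⁻_s, f j ∂(fun _ => μ)) (Function.update x i a)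
          = (∫⋯∫⁻_s, f j ∂(fun _ => μ)) x := by
        intro j hj a
        exact lmarginal_update_of_notMem (μ := fun _ => μ) (hf j) hi x a |>.trans (by
          congr 1; ext y; exact hfS j i hj y a)
      calc _ ≤ ∫⁻ a, ∏ j, ((∫⋯∫⁻_s, f j ∂(fun _ => μ)) (Function.update x i a)) ^ p ∂μ :=
            lintegral_mono fun a => ih _
        _ = ∫⁻ a, (∏ j with i ∉ S j, ((∫⋯∫⁻_s, f j ∂(fun _ => μ)) x) ^ p) *
             (∏ j with i ∈ S j, ((∫⋯∫⁻_s, f j ∂(fun _ => μ)) (Function.update x i a)) ^ p) ∂μ := by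
            refine lintegral_congr fun a => ?_
            rw [mul_comm, ← Finset.prod_filter_mul_prod_filter_not _ (fun j => i ∈ S j)]
            congr 1
            refine Finset.prod_congr rfl fun j hj => ?_
            rw [hconst j (Finset.mem_filter.1 hj).2]
        _ = (∏ j with i ∉ S j, ((∫⋯∫⁻_s, f j ∂(fun _ => μ)) x) ^ p) *
             ∫⁻ a, (∏ j with i ∈ S j,
              ((∫⋯∫⁻_s, f j ∂(fun _ => μ)) (Function.update x i a)) ^ p) ∂μ := by
            rw [lintegral_const_mul]
            refine Finset.measurable_prod _ fun j _ => ?_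
            exact (((hf j).lmarginal _).comp (measurable_update x)).pow_const p
        _ ≤ (∏ j with i ∉ S j, ((∫⋯∫⁻_s, f j ∂(fun _ => μ)) x) ^ p) *
             ∏ j with i ∈ S j,
              (∫⁻ a, (∫⋯∫⁻_s, f j ∂(fun _ => μ)) (Function.update x i a) ∂μ) ^ p := by
            gcongr
            refine ENNReal.lintegral_prod_norm_pow_le _ (fun j _ => ?_) (hS i) (fun _ _ => hp)
            exact (((hf j).lmarginal _).comp (measurable_update x)).aemeasurable
        _ = _ := by
            rw [mul_comm, ← Finset.prod_filter_mul_prod_filter_not Finset.univ (fun j => i ∈ S j)]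
            congr 1
            · refine Finset.prod_congr rfl fun j hj => ?_
              rw [lmarginal_insert _ (hf j) hi]
            · refine Finset.prod_congr rfl fun j hj => ?_
              rw [lmarginal_insert _ (hf j) hi]
              simp_rw [hconst j (Finset.mem_filter.1 hj).2]
              simp
  rcases isEmpty_or_nonempty (ι → X) with he | ⟨⟨x⟩⟩
  · simp
  · have := key Finset.univ x
    simpa using this

lemma aux_gibbs (r s G : ℝ) (hr : 0 ≤ r) (hs : 0 < s) :
    r * G + r - s * Real.exp G ≤ r * Real.log (r / s) := by
  rcases hr.eq_or_lt with rfl | hr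
  · simp; positivity
  · have h := Real.add_one_le_exp (G - Real.log (r / s))
    rw [Real.exp_sub, Real.exp_log (by positivity)] at h
    have h2 := mul_le_mul_of_nonneg_left h hr.le
    have : r * (Real.exp G / (r / s)) = s * Real.exp G := by field_simp
    rw [this] at h2
    linarith

lemma aux_card (N k : ℕ) [NeZero N] (hkN : k ≤ N) (i : Fin N) :
    (Finset.univ.filter (fun j : Fin N => ((i - j : Fin N) : ℕ) < k)).card = k := by
  have : (Finset.univ.filter (fun j : Fin N => ((i - j : Fin N) : ℕ) < k)).card =
      (Finset.univ.filter (fun j : Fin N => (j : ℕ) < k)).card := by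
    refine Finset.card_equiv (Equiv.subLeft i) fun j => ?_
    simp
  rw [this, Fin.card_filter_val_lt]
  omega

lemma aux_hoeffding {Y : Type*} [MeasurableSpace Y] (μ : Measure Y) [IsProbabilityMeasure μ]
    (φ : Y → ℝ) (hφ : Measurable φ) (hb : ∀ y, φ y ∈ Set.Icc (-1 : ℝ) 1) (t : ℝ) :
    ∫⁻ y, ENNReal.ofReal (Real.exp (t * (φ y - ∫ y, φ y ∂μ) - t ^ 2 / 2)) ∂μ ≤ 1 := by
  have h := ProbabilityTheory.hasSubgaussianMGF_of_mem_Icc (μ := μ) hφ.aemeasurable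
    (Filter.Eventually.of_forall hb)
  have h1 := h.integrable_exp_mul t
  have h2 := h.mgf_le t
  have e : ∀ y, Real.exp (t * (φ y - ∫ y, φ y ∂μ) - t ^ 2 / 2) =
      Real.exp (t * (φ y - ∫ y, φ y ∂μ)) * Real.exp (- (t ^ 2 / 2)) := by
    intro y; rw [← Real.exp_add]; congr 1
  simp_rw [e]
  rw [← ofReal_integral_eq_lintegral_ofReal (h1.mul_const _)
    (Filter.Eventually.of_forall fun y => by positivity), integral_mul_const,
    ← ENNReal.ofReal_one]
  refine ENNReal.ofReal_le_ofReal ?_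
  have h3 : ∫ y, Real.exp (t * (φ y - ∫ y, φ y ∂μ)) ∂μ ≤ Real.exp (t ^ 2 / 2) := by
    refine le_trans h2 (Real.exp_le_exp.2 ?_)
    norm_num
  calc _ ≤ Real.exp (t ^ 2 / 2) * Real.exp (- (t ^ 2 / 2)) := by gcongr
    _ = 1 := by rw [← Real.exp_add]; simp

lemma aux_perm {X : Type*} [MeasurableSpace X] (ν : Measure X) [IsFiniteMeasure ν]
    (N : ℕ) (e : Equiv.Perm (Fin N)) (F : (Fin N → X) → ℝ) :
    ∫ x, F (x ∘ e) ∂(Measure.pi fun _ : Fin N => ν) =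
      ∫ x, F x ∂(Measure.pi fun _ : Fin N => ν) := by
  have h := (measurePreserving_piCongrLeft (α := fun _ => X) (fun _ : Fin N => ν)
    e.symm).integral_comp' F
  rw [← h]
  congr 1
  ext x
  congr 1
  ext i
  obtain ⟨j, rfl⟩ := e.symm.surjective i
  rw [MeasurableEquiv.piCongrLeft_apply_apply]
  simp

lemma aux_core {X : Type*} [MeasurableSpace X] (ν : Measure X) [IsFiniteMeasure ν]
    (N k : ℕ) (hk : 1 ≤ k) (hkN : k ≤ N)
    (ρN : (Fin N → X) → ℝ) (σ : X → ℝ)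
    (hσm : Measurable σ)
    (hρ0 : 0 ≤ ρN) (hσ0 : 0 ≤ σ) (hσpos : ∀ᵐ x ∂ν, 0 < σ x)
    (hρi : Integrable ρN (Measure.pi fun _ : Fin N => ν)) (hσi : Integrable σ ν)
    (hρ1 : ∫ x, ρN x ∂(Measure.pi fun _ : Fin N => ν) = 1)
    (hσ1 : ∫ x, σ x ∂ν = 1)
    (hsym : ∀ (e : Equiv.Perm (Fin N)) (x : Fin N → X), ρN (x ∘ e) = ρN x)
    (hHint : Integrable (fun x => ρN x * Real.log (ρN x / ∏ i, σ (x i)))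
      (Measure.pi fun _ : Fin N => ν))
    (φ : (Fin k → X) → ℝ) (hφ : Measurable φ) (hb : ∀ y, φ y ∈ Set.Icc (-1 : ℝ) 1) (t : ℝ) :
    (N / k : ℝ) * (t * (∫ x, ρN x * φ (fun a => x (Fin.castLE hkN a))
          ∂(Measure.pi fun _ : Fin N => ν)
        - ∫ y, (∏ i, σ (y i)) * φ y ∂(Measure.pi fun _ : Fin k => ν)) - t ^ 2 / 2) ≤
      ∫ x, ρN x * Real.log (ρN x / ∏ i, σ (x i)) ∂(Measure.pi fun _ : Fin N => ν) := by
  have : NeZero N := ⟨by omega⟩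
  have hk0 : (k : ℝ) ≠ 0 := by positivity
  set μ := ν.withDensity (fun x => ENNReal.ofReal (σ x)) with hμ
  have hμp : IsProbabilityMeasure μ := by
    refine ⟨?_⟩
    rw [hμ, withDensity_apply _ MeasurableSet.univ, Measure.restrict_univ,
      ← ofReal_integral_eq_lintegral_ofReal hσi (Filter.Eventually.of_forall hσ0), hσ1]
    simp
  have hmq : ∫ y, (∏ i, σ (y i)) * φ y ∂(Measure.pi fun _ : Fin k => ν) =
      ∫ y, φ y ∂(Measure.pi fun _ : Fin k => μ) := by
    rw [hμ, aux_pi_withDensity ν k σ hσ0 hσi,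
      integral_withDensity_eq_integral_toReal_smul (by fun_prop)
      (Filter.Eventually.of_forall fun _ => ENNReal.ofReal_lt_top)]
    refine integral_congr_ae (Filter.Eventually.of_forall fun y => ?_)
    simp only [smul_eq_mul]
    rw [ENNReal.toReal_ofReal (Finset.prod_nonneg fun i _ => hσ0 _)]
  rw [hmq]
  set m := ∫ y, φ y ∂(Measure.pi fun _ : Fin k => μ) with hm
  set A := ∫ x, ρN x * φ (fun a => x (Fin.castLE hkN a)) ∂(Measure.pi fun _ : Fin N => ν) with hA
  let g : Fin N → Fin k → Fin N := fun j a => Fin.castLE hkN a + j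
  have hg : ∀ j, Function.Injective (g j) := fun j a b hab =>
    Fin.castLE_injective hkN (add_right_cancel hab)
  let u : Fin N → (Fin N → X) → ℝ := fun j x => t * (φ (fun a => x (g j a)) - m) - t ^ 2 / 2
  have hφg : ∀ j, Measurable (fun x : Fin N → X => φ (fun a => x (g j a))) := fun j =>
    hφ.comp (by fun_prop)
  have hu : ∀ j, Measurable (u j) := fun j => (((hφg j).sub_const _).const_mul _).sub_const _
  let f : Fin N → (Fin N → X) → ℝ≥0∞ := fun j x => ENNReal.ofReal (Real.exp (u j x))
  have hf : ∀ j, Measurable (f j) := fun j => (Real.measurable_exp.comp (hu j)).ennreal_ofReal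
  let S : Fin N → Finset (Fin N) := fun j => Finset.univ.filter (fun i => ((i - j : Fin N) : ℕ) < k)
  have hfin := aux_finner μ S (1 / k : ℝ) (by positivity) (by
    intro i
    rw [Finset.sum_const]
    have := aux_card N k hkN i
    simp only [S, Finset.mem_filter, Finset.mem_univ, true_and]
    rw [this, nsmul_eq_mul]
    field_simp) f hf (by
    intro j i hi x a
    have : (fun b => (Function.update x i a) (g j b)) = fun b => x (g j b) := by
      ext b
      rw [Function.update_of_ne]
      rintro rfl
      apply hi
      simp [S, g]
    simp only [f, u, this])
  have hf1 : ∀ j, ∫⁻ x, f j x ∂(Measure.pi fun _ : Fin N => μ) ≤ 1 := by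
    intro j
    refine le_trans (le_of_eq ?_)
      (aux_hoeffding (Measure.pi fun _ : Fin k => μ) φ hφ hb t)
    exact (aux_proj μ N k (g j) (hg j)).lintegral_comp
      (f := fun y => ENNReal.ofReal (Real.exp (t * (φ y - m) - t ^ 2 / 2))) (by fun_prop)
  have hfin1 : ∫⁻ x, ∏ j, f j x ^ (1 / k : ℝ) ∂(Measure.pi fun _ : Fin N => μ) ≤ 1 :=
    hfin.trans (Finset.prod_le_one' fun j _ => ENNReal.rpow_le_one (hf1 j) (by positivity))
  let G : (Fin N → X) → ℝ := fun x => ∑ j, (1 / k : ℝ) * u j x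
  have hG : Measurable G := Finset.measurable_sum _ fun j _ => (hu j).const_mul _
  have hGf : ∀ x, ∏ j, f j x ^ (1 / k : ℝ) = ENNReal.ofReal (Real.exp (G x)) := by
    intro x
    simp only [G, f]
    rw [Real.exp_sum, ENNReal.ofReal_prod_of_nonneg (fun _ _ => (Real.exp_pos _).le)]
    refine Finset.prod_congr rfl fun j _ => ?_
    rw [ENNReal.ofReal_rpow_of_pos (Real.exp_pos _), ← Real.exp_mul, mul_comm]
  simp_rw [hGf] at hfin1
  have hs0 : ∀ x : Fin N → X, 0 ≤ ∏ i, σ (x i) := fun x => Finset.prod_nonneg fun i _ => hσ0 _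
  have hsG : ∫⁻ x, ENNReal.ofReal ((∏ i, σ (x i)) * Real.exp (G x))
      ∂(Measure.pi fun _ : Fin N => ν) ≤ 1 := by
    refine le_trans (le_of_eq ?_) hfin1
    rw [hμ, aux_pi_withDensity ν N σ hσ0 hσi,
      lintegral_withDensity_eq_lintegral_mul _ (by fun_prop) (by fun_prop)]
    refine lintegral_congr fun x => ?_
    rw [Pi.mul_apply, ENNReal.ofReal_mul (hs0 x)]
  have hsGm : Measurable (fun x : Fin N → X => (∏ i, σ (x i)) * Real.exp (G x)) := by fun_prop
  have hsG0 : ∀ x, 0 ≤ (∏ i, σ (x i)) * Real.exp (G x) := fun x =>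
    mul_nonneg (hs0 x) (Real.exp_pos _).le
  have hsGi : Integrable (fun x : Fin N → X => (∏ i, σ (x i)) * Real.exp (G x))
      (Measure.pi fun _ : Fin N => ν) := by
    refine ⟨hsGm.aestronglyMeasurable, ?_⟩
    rw [hasFiniteIntegral_iff_ofReal (Filter.Eventually.of_forall hsG0)]
    exact hsG.trans_lt ENNReal.one_lt_top
  have hsG1 : ∫ x, (∏ i, σ (x i)) * Real.exp (G x) ∂(Measure.pi fun _ : Fin N => ν) ≤ 1 := by
    rw [integral_eq_lintegral_of_nonneg_ae (Filter.Eventually.of_forall hsG0)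
      hsGm.aestronglyMeasurable]
    exact ENNReal.toReal_le_of_le_ofReal zero_le_one (by simpa using hsG)
  have hρφ : ∀ j, Integrable (fun x => ρN x * φ (fun a => x (g j a)))
      (Measure.pi fun _ : Fin N => ν) := fun j =>
    hρi.mul_bdd (c := 1) (hφg j).aestronglyMeasurable
      (Filter.Eventually.of_forall fun x => by
        rw [Real.norm_eq_abs]; exact abs_le.2 (hb _))
  have hAj : ∀ j, ∫ x, ρN x * φ (fun a => x (g j a)) ∂(Measure.pi fun _ : Fin N => ν) = A := by
    intro j
    rw [hA, ← aux_perm ν N (Equiv.addRight j)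
      (fun x => ρN x * φ (fun a => x (Fin.castLE hkN a)))]
    refine integral_congr_ae (Filter.Eventually.of_forall fun x => ?_)
    simp only [hsym]
    rfl
  have hru : ∀ j x, ρN x * ((1 / k : ℝ) * u j x) =
      (t / k) * (ρN x * φ (fun a => x (g j a))) - ((t * m + t ^ 2 / 2) / k) * ρN x := by
    intro j x
    simp only [u]
    ring
  have hrui : ∀ j, Integrable (fun x => ρN x * ((1 / k : ℝ) * u j x))
      (Measure.pi fun _ : Fin N => ν) := by
    intro j
    simp_rw [hru]
    exact ((hρφ j).const_mul _).sub (hρi.const_mul _)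
  have hrG : ∀ x, ρN x * G x = ∑ j, ρN x * ((1 / k : ℝ) * u j x) := fun x => Finset.mul_sum _ _ _
  have hrGi : Integrable (fun x => ρN x * G x) (Measure.pi fun _ : Fin N => ν) := by
    simp_rw [hrG]
    exact integrable_finsetSum _ fun j _ => hrui j
  have hrG1 : ∫ x, ρN x * G x ∂(Measure.pi fun _ : Fin N => ν) =
      (N / k : ℝ) * (t * (A - m) - t ^ 2 / 2) := by
    simp_rw [hrG]
    rw [integral_finsetSum _ fun j _ => hrui j]
    have : ∀ j, ∫ x, ρN x * ((1 / k : ℝ) * u j x) ∂(Measure.pi fun _ : Fin N => ν) =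
        (t / k) * A - ((t * m + t ^ 2 / 2) / k) := by
      intro j
      simp_rw [hru]
      rw [integral_sub ((hρφ j).const_mul _) (hρi.const_mul _), integral_const_mul,
        integral_const_mul, hAj, hρ1, mul_one]
    simp_rw [this]
    rw [Finset.sum_const, Finset.card_univ, Fintype.card_fin, nsmul_eq_mul]
    ring
  have hpos : ∀ᵐ x ∂(Measure.pi fun _ : Fin N => ν), 0 < ∏ i, σ (x i) := by
    have : ∀ᵐ x ∂(Measure.pi fun _ : Fin N => ν), ∀ i, 0 < σ (x i) := by
      rw [ae_all_iff]
      intro i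
      exact (Measure.quasiMeasurePreserving_eval (fun _ : Fin N => ν) i).ae hσpos
    filter_upwards [this] with x hx
    exact Finset.prod_pos fun i _ => hx i
  have hfinal : ∫ x, (ρN x * G x + ρN x - (∏ i, σ (x i)) * Real.exp (G x))
      ∂(Measure.pi fun _ : Fin N => ν) ≤
      ∫ x, ρN x * Real.log (ρN x / ∏ i, σ (x i)) ∂(Measure.pi fun _ : Fin N => ν) := by
    refine integral_mono_ae ((hrGi.add hρi).sub hsGi) hHint ?_
    filter_upwards [hpos] with x hx
    exact aux_gibbs _ _ _ (hρ0 x) hx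
  have hsplit : ∫ x, (ρN x * G x + ρN x - (∏ i, σ (x i)) * Real.exp (G x))
      ∂(Measure.pi fun _ : Fin N => ν) = (N / k : ℝ) * (t * (A - m) - t ^ 2 / 2) + 1 -
      ∫ x, (∏ i, σ (x i)) * Real.exp (G x) ∂(Measure.pi fun _ : Fin N => ν) := by
    have hadd : Integrable (fun x => ρN x * G x + ρN x) (Measure.pi fun _ : Fin N => ν) :=
      hrGi.add hρi
    rw [integral_sub hadd hsGi, integral_add hrGi hρi, hrG1, hρ1]
  linarith

/-- Marginal control by the renormalized relative entropy: if ρ^{(N)} is a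
permutation-invariant probability density on X^N and σ a probability density on X,
then the k-marginal satisfies
‖ρ^{(N|k)} − σ^{⊗k}‖_{L¹(ν^{⊗k})} ≤ √( 2k · H_N(ρ^{(N)} ‖ σ^{⊗N}) ), with
H_N = (1/N) ∫ ρ^{(N)} log(ρ^{(N)}/σ^{⊗N}) dν^{⊗N}. -/
theorem stmt_16 {X : Type*} [MeasurableSpace X] (ν : Measure X) [IsFiniteMeasure ν]
    (N k : ℕ) (hk : 1 ≤ k) (hkN : k ≤ N)
    (ρN : (Fin N → X) → ℝ) (σ : X → ℝ)
    (hρm : Measurable ρN) (hσm : Measurable σ)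
    (hρ0 : 0 ≤ ρN) (hσ0 : 0 ≤ σ) (hσpos : ∀ᵐ x ∂ν, 0 < σ x)
    (hρi : Integrable ρN (Measure.pi fun _ : Fin N => ν)) (hσi : Integrable σ ν)
    (hρ1 : ∫ x, ρN x ∂(Measure.pi fun _ : Fin N => ν) = 1)
    (hσ1 : ∫ x, σ x ∂ν = 1)
    (hsym : ∀ (e : Equiv.Perm (Fin N)) (x : Fin N → X), ρN (x ∘ e) = ρN x)
    (hHint : Integrable (fun x => ρN x * Real.log (ρN x / ∏ i, σ (x i)))
      (Measure.pi fun _ : Fin N => ν)) :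
    ∫ y : Fin k → X,
        |(∫ z : Fin (N - k) → X,
            ρN (fun i => if h : (i : ℕ) < k then y ⟨i, h⟩
              else z ⟨(i : ℕ) - k, by have hi := i.isLt; omega⟩)
            ∂(Measure.pi fun _ : Fin (N - k) => ν)) -
          ∏ i, σ (y i)| ∂(Measure.pi fun _ : Fin k => ν)
      ≤ Real.sqrt (2 * k *
          ((1 / N) * ∫ x, ρN x * Real.log (ρN x / ∏ i, σ (x i))
            ∂(Measure.pi fun _ : Fin N => ν))) := by
  
  let T : (Fin k → X) × (Fin (N - k) → X) → (Fin N → X) := fun p i =>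
    if h : (i : ℕ) < k then p.1 ⟨i, h⟩ else p.2 ⟨(i : ℕ) - k, by have hi := i.isLt; omega⟩
  have hT : MeasurePreserving T
      ((Measure.pi fun _ : Fin k => ν).prod (Measure.pi fun _ : Fin (N - k) => ν))
      (Measure.pi fun _ : Fin N => ν) := by
    refine aux_glue ν N k hkN T (fun p i a h => ?_) (fun p i b h => ?_)
    · have hi : (i : ℕ) < k := by have := a.isLt; omega
      simp only [T, dif_pos hi]
      exact congrArg p.1 (Fin.ext h)
    · have hi : ¬ (i : ℕ) < k := by omega
      simp only [T, dif_neg hi]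
      refine congrArg p.2 (Fin.ext ?_)
      change (i : ℕ) - k = b
      omega
  let R : (Fin k → X) → ℝ := fun y => ∫ z, ρN (T (y, z)) ∂(Measure.pi fun _ : Fin (N - k) => ν)
  change ∫ y : Fin k → X, |R y - ∏ i, σ (y i)| ∂(Measure.pi fun _ : Fin k => ν) ≤ _
  have hRm : Measurable R :=
    ((hρm.comp hT.measurable).stronglyMeasurable.integral_prod_right').measurable
  have hTi : Integrable (fun p => ρN (T p))
      ((Measure.pi fun _ : Fin k => ν).prod (Measure.pi fun _ : Fin (N - k) => ν)) :=
    hT.integrable_comp_of_integrable hρi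
  have hRi : Integrable R (Measure.pi fun _ : Fin k => ν) := hTi.integral_prod_left
  have hsi : Integrable (fun y : Fin k → X => ∏ i, σ (y i)) (Measure.pi fun _ : Fin k => ν) :=
    Integrable.fintype_prod (f := fun _ => σ) fun _ => hσi
  let φ : (Fin k → X) → ℝ := fun y => if 0 ≤ R y - ∏ i, σ (y i) then 1 else -1
  have hφ : Measurable φ :=
    Measurable.ite (measurableSet_le measurable_const (by fun_prop)) measurable_const
      measurable_const
  have hb : ∀ y, φ y ∈ Set.Icc (-1 : ℝ) 1 := by
    intro y
    simp only [φ]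
    split_ifs <;> norm_num
  have hbn : ∀ y, ‖φ y‖ ≤ 1 := fun y => by rw [Real.norm_eq_abs]; exact abs_le.2 (hb y)
  have habs : ∀ y, |R y - ∏ i, σ (y i)| = R y * φ y - (∏ i, σ (y i)) * φ y := by
    intro y
    simp only [φ]
    split_ifs with h
    · rw [abs_of_nonneg h]; ring
    · rw [abs_of_neg (not_le.1 h)]; ring
  have hRφ : ∫ y, R y * φ y ∂(Measure.pi fun _ : Fin k => ν) =
      ∫ x, ρN x * φ (fun a => x (Fin.castLE hkN a)) ∂(Measure.pi fun _ : Fin N => ν) := by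
    have hpr : ∀ p, (fun a : Fin k => T p (Fin.castLE hkN a)) = p.1 := by
      intro p
      ext a
      simp [T]
    have hm1 : Measurable (fun x : Fin N → X => ρN x * φ (fun a => x (Fin.castLE hkN a))) :=
      hρm.mul (hφ.comp (by fun_prop))
    rw [← hT.map_eq, integral_map hT.measurable.aemeasurable hm1.aestronglyMeasurable]
    simp_rw [hpr]
    rw [integral_prod]
    · refine integral_congr_ae (Filter.Eventually.of_forall fun y => ?_)
      simp only [R]
      rw [integral_mul_const]
    · exact hTi.mul_bdd (c := 1) (hφ.comp measurable_fst).aestronglyMeasurable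
        (Filter.Eventually.of_forall fun p => hbn _)
  set D := ∫ y : Fin k → X, |R y - ∏ i, σ (y i)| ∂(Measure.pi fun _ : Fin k => ν) with hD
  have hcore := aux_core ν N k hk hkN ρN σ hσm hρ0 hσ0 hσpos hρi hσi hρ1 hσ1 hsym hHint φ hφ hb D
  have hDeq : D = ∫ x, ρN x * φ (fun a => x (Fin.castLE hkN a)) ∂(Measure.pi fun _ : Fin N => ν)
        - ∫ y, (∏ i, σ (y i)) * φ y ∂(Measure.pi fun _ : Fin k => ν) := by
    rw [← hRφ, hD]
    simp_rw [habs]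
    exact integral_sub
      (hRi.mul_bdd (c := 1) hφ.aestronglyMeasurable (Filter.Eventually.of_forall hbn))
      (hsi.mul_bdd (c := 1) hφ.aestronglyMeasurable (Filter.Eventually.of_forall hbn))
  rw [← hDeq] at hcore
  apply Real.le_sqrt_of_sq_le
  have hk0 : (0 : ℝ) < k := by exact_mod_cast hk
  have hN0 : (0 : ℝ) < N := by exact_mod_cast (by omega : 0 < N)
  have h2 := mul_le_mul_of_nonneg_left hcore (show (0 : ℝ) ≤ 2 * k * (1 / N) by positivity)
  have h3 : (2 * k * (1 / N) : ℝ) * ((N / k : ℝ) * (D * D - D ^ 2 / 2)) = D ^ 2 := by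
    field_simp
    ring
  rw [h3] at h2
  linarith
end
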